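/- arXiv:2203.00134 — 2 statements merged into one kernel-verified Lean document; each statement's English description precedes it below -/
import Mathlib

section
/- (Distant targets lemma.) In the common improvement capacity model with capacity Δ > 0: let A be a finite multiset of agent positions and T = {τ_1 < τ_2 < ⋯ < τ_m} ⊆ ℝ a finite target set satisfying τ_{j+2} − τ_j ≥ Δ for all 1 ≤ j ≤ m − 2. Then there exists T' ⊆ T such that any two distinct elements of T' are at distance at least 2Δ, |T'| ≤ ⌈m/4⌉, and SW_A(T') ≥ SW_A(T)/4. -/
/-- Improvement of an agent at position `p` with capacity `Δ` given target set `T`: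
the agent moves to the smallest target `τ ∈ T` with `p < τ ≤ p + Δ`, if any. -/
noncomputable def imp (Δ p : ℝ) (T : Finset ℝ) : ℝ :=
  if h : (T.filter (fun τ => p < τ ∧ τ ≤ p + Δ)).Nonempty then
    (T.filter (fun τ => p < τ ∧ τ ≤ p + Δ)).min' h - p
  else 0

/-- Social welfare of a finite multiset `A` of agent positions sharing common capacity `Δ`. -/
noncomputable def swM (Δ : ℝ) (A : Multiset ℝ) (T : Finset ℝ) : ℝ :=
  (A.map (fun p => imp Δ p T)).sum

/-- Rank of `x` in `T`. -/
noncomputable def rk (T : Finset ℝ) (x : ℝ) : ℕ := (T.filter (fun t => t < x)).card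

/-- Elements of `T` whose rank is `i` mod 4. -/
noncomputable def cls (T : Finset ℝ) (i : ℕ) : Finset ℝ := T.filter (fun x => rk T x % 4 = i)

lemma rk_lt {T : Finset ℝ} {x y : ℝ} (hx : x ∈ T) (h : x < y) : rk T x < rk T y := by
  apply Finset.card_lt_card
  rw [Finset.ssubset_iff_of_subset]
  · exact ⟨x, by simp [hx, h], by simp⟩
  · intro t ht
    simp only [Finset.mem_filter] at ht ⊢
    exact ⟨ht.1, ht.2.trans h⟩

lemma rk_lt_card {T : Finset ℝ} {x : ℝ} (hx : x ∈ T) : rk T x < T.card := by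
  apply Finset.card_lt_card
  rw [Finset.ssubset_iff_of_subset (Finset.filter_subset _ _)]
  exact ⟨x, hx, by simp⟩

lemma cls_card (T : Finset ℝ) (i : ℕ) : (cls T i).card ≤ (T.card + 3) / 4 := by
  rw [← Finset.card_range ((T.card + 3) / 4)]
  apply Finset.card_le_card_of_injOn (fun x => rk T x / 4)
  · intro x hx
    simp only [cls, Finset.coe_filter, Set.mem_ofPred_eq] at hx
    have := rk_lt_card hx.1
    simp only [Finset.coe_range, Set.mem_Iio]
    omega
  · intro x hx y hy hxy
    simp only [cls, Finset.coe_filter, Set.mem_ofPred_eq] at hx hy hxy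
    rcases lt_trichotomy x y with h | h | h
    · have := rk_lt hx.1 h
      omega
    · exact h
    · have := rk_lt hy.1 h
      omega

lemma cls_dist {Δ : ℝ} {T : Finset ℝ}
    (hsep : ∀ a ∈ T, ∀ b ∈ T, ∀ c ∈ T, a < b → b < c → Δ ≤ c - a) {i : ℕ} {x y : ℝ}
    (hx : x ∈ cls T i) (hy : y ∈ cls T i) (h : x < y) : 2 * Δ ≤ y - x := by
  simp only [cls, Finset.mem_filter] at hx hy
  have h1 := rk_lt hx.1 h
  have h2 : rk T y ≤ rk T x + 1 + (T.filter (fun t => x < t ∧ t < y)).card := by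
    have hs : T.filter (fun t => t < y) ⊆
        (T.filter (fun t => t < x) ∪ {x}) ∪ T.filter (fun t => x < t ∧ t < y) := by
      intro t ht
      simp only [Finset.mem_filter, Finset.mem_union, Finset.mem_singleton] at ht ⊢
      rcases lt_trichotomy t x with h | h | h <;> tauto
    have e1 := Finset.card_le_card hs
    have e2 := Finset.card_union_le (T.filter (fun t => t < x) ∪ {x})
      (T.filter (fun t => x < t ∧ t < y))
    have e3 := Finset.card_union_le (T.filter (fun t => t < x)) {x}
    rw [Finset.card_singleton] at e3
    unfold rk
    omega
  have h3 : 3 ≤ (T.filter (fun t => x < t ∧ t < y)).card := by omega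
  let f := (T.filter (fun t => x < t ∧ t < y)).orderEmbOfCardLe h3
  have hf : ∀ j, f j ∈ T ∧ x < f j ∧ f j < y := fun j => by
    have := Finset.orderEmbOfCardLe_mem _ h3 j
    simpa only [Finset.mem_filter] using this
  have h01 : f 0 < f 1 := f.strictMono (by decide)
  have h12 : f 1 < f 2 := f.strictMono (by decide)
  have a1 := hsep x hx.1 _ (hf 0).1 _ (hf 1).1 (hf 0).2.1 h01
  have a2 := hsep _ (hf 1).1 _ (hf 2).1 y hy.1 h12 (hf 2).2.2
  linarith

lemma imp_nonneg' (Δ p : ℝ) (T : Finset ℝ) : 0 ≤ imp Δ p T := by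
  unfold imp
  split_ifs with h
  · have := Finset.min'_mem _ h
    simp only [Finset.mem_filter] at this
    linarith [this.2.1]
  · exact le_rfl

lemma imp_cls (Δ p : ℝ) (T : Finset ℝ) :
    imp Δ p T ≤ ∑ i ∈ Finset.range 4, imp Δ p (cls T i) := by
  by_cases h : (T.filter (fun τ => p < τ ∧ τ ≤ p + Δ)).Nonempty
  · have hm := Finset.min'_mem _ h
    set τ := (T.filter (fun τ => p < τ ∧ τ ≤ p + Δ)).min' h with hτ
    have hm' := Finset.mem_filter.1 hm
    have hi : rk T τ % 4 ∈ Finset.range 4 := Finset.mem_range.2 (by omega)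
    refine le_trans ?_ (Finset.single_le_sum (f := fun i => imp Δ p (cls T i))
      (fun i _ => imp_nonneg' Δ p _) hi)
    have hne : ((cls T (rk T τ % 4)).filter (fun τ => p < τ ∧ τ ≤ p + Δ)).Nonempty :=
      ⟨τ, by simp only [cls, Finset.mem_filter]; exact ⟨⟨hm'.1, trivial⟩, hm'.2⟩⟩
    simp only [imp, dif_pos h, dif_pos hne]
    apply sub_le_sub_right
    apply Finset.min'_subset
    exact Finset.filter_subset_filter _ (Finset.filter_subset _ _)
  · have : imp Δ p T = 0 := by simp only [imp, dif_neg h]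
    rw [this]
    exact Finset.sum_nonneg (fun i _ => imp_nonneg' Δ p _)

lemma sw_cls (Δ : ℝ) (A : Multiset ℝ) (T : Finset ℝ) :
    swM Δ A T ≤ ∑ i ∈ Finset.range 4, swM Δ A (cls T i) := by
  unfold swM
  rw [← Multiset.sum_map_sum]
  exact Multiset.sum_map_le_sum_map _ _ (fun p _ => imp_cls Δ p T)

/-- distant targets lemma: if every pair of targets two apart in the sorted
order of `T` is at distance at least `Δ` (equivalently, any three increasing targets
`a < b < c` in `T` satisfy `c - a ≥ Δ`), then there is a subset `T' ⊆ T` whose elements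
are pairwise at distance at least `2Δ`, of size at most `⌈|T|/4⌉`, retaining at least a
quarter of the social welfare. -/
theorem distant_targets_lemma
    (Δ : ℝ) (hΔ : 0 < Δ) (A : Multiset ℝ) (T : Finset ℝ)
    (hsep : ∀ a ∈ T, ∀ b ∈ T, ∀ c ∈ T, a < b → b < c → Δ ≤ c - a) :
    ∃ T' : Finset ℝ, T' ⊆ T ∧
      (∀ x ∈ T', ∀ y ∈ T', x ≠ y → 2 * Δ ≤ |x - y|) ∧
      T'.card ≤ (T.card + 3) / 4 ∧
      swM Δ A T / 4 ≤ swM Δ A T' := by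
  have key : ∃ i ∈ Finset.range 4, swM Δ A T / 4 ≤ swM Δ A (cls T i) := by
    apply Finset.exists_le_of_sum_le (by simp)
    refine le_trans (le_of_eq ?_) (sw_cls Δ A T)
    simp
    ring
  obtain ⟨i, -, hi⟩ := key
  refine ⟨cls T i, Finset.filter_subset _ _, ?_, cls_card T i, hi⟩
  intro x hx y hy hxy
  rcases lt_or_gt_of_ne hxy with h | h
  · have := cls_dist hsep hx hy h
    rw [abs_sub_comm]
    exact this.trans (le_abs_self _)
  · exact (cls_dist hsep hy hx h).trans (le_abs_self _)
end

section
/- (Mass near the left endpoint under an optimal single target.) In the common improvement capacity model with capacity Δ > 0: let A be a nonempty finite multiset of agent positions with A ⊆ [τ − Δ, τ), and suppose τ maximizes the single-target social welfare of A, i.e., SW_A({τ}) ≥ SW_A({σ}) for every σ ∈ ℝ. Then for every x ∈ [0, 1], the number of elements of A (counted with multiplicity) lying in [τ − Δ, τ − Δ + xΔ) is at least (x/(1+x))·|A|. -/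
lemma imp_singleton (Δ p σ : ℝ) :
    imp Δ p {σ} = if p < σ ∧ σ ≤ p + Δ then σ - p else 0 := by
  unfold imp
  by_cases h : p < σ ∧ σ ≤ p + Δ
  · have e : ({σ} : Finset ℝ).filter (fun τ => p < τ ∧ τ ≤ p + Δ) = {σ} := by
      rw [Finset.filter_singleton, if_pos h]
    simp [e, h]
  · have e : ({σ} : Finset ℝ).filter (fun τ => p < τ ∧ τ ≤ p + Δ) = ∅ := by
      rw [Finset.filter_singleton, if_neg h]
    rw [if_neg h, dif_neg]
    simp [e]

lemma sw_shift (Δ τ x : ℝ) (hΔ : 0 < Δ) (hx0 : 0 ≤ x) (A : Multiset ℝ)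
    (hloc : ∀ q ∈ A, τ - Δ ≤ q ∧ q < τ) :
    swM Δ A {τ} + x * Δ * (Multiset.card A : ℝ) ≤ swM Δ A {τ + x * Δ} + (1 + x) * Δ *
      ((A.filter (fun q => τ - Δ ≤ q ∧ q < τ - Δ + x * Δ)).card : ℝ) := by
  have hxΔ : 0 ≤ x * Δ := by positivity
  induction A using Multiset.induction_on with
  | empty => simp [swM]
  | cons a A ih =>
    have ih' := ih (fun q hq => hloc q (Multiset.mem_cons_of_mem hq))
    obtain ⟨h1, h2⟩ := hloc a (Multiset.mem_cons_self a A)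
    have s : ∀ σ, swM Δ (a ::ₘ A) {σ} = imp Δ a {σ} + swM Δ A {σ} := by
      intro σ; simp [swM]
    rw [s, s, imp_singleton, imp_singleton, if_pos ⟨h2, by linarith⟩, Multiset.card_cons]
    by_cases h : a < τ - Δ + x * Δ
    · rw [Multiset.filter_cons_of_pos _ ⟨h1, h⟩, if_neg (by rintro ⟨_, h4⟩; linarith),
        Multiset.card_cons]
      push_cast
      linarith
    · rw [Multiset.filter_cons_of_neg _ (fun h' => h h'.2),
        if_pos ⟨by linarith, by linarith⟩]
      push_cast
      linarith

/-- if `τ` is an optimal single target for a nonempty set of agents contained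
in `[τ - Δ, τ)`, then for every `x ∈ [0,1]` at least an `x/(1+x)` fraction of the agents
lie in `[τ - Δ, τ - Δ + xΔ)`. -/
theorem mass_near_left_endpoint
    (Δ τ : ℝ) (hΔ : 0 < Δ) (A : Multiset ℝ) (hA : A ≠ 0)
    (hloc : ∀ q ∈ A, τ - Δ ≤ q ∧ q < τ)
    (hopt : ∀ σ : ℝ, swM Δ A {σ} ≤ swM Δ A {τ})
    (x : ℝ) (hx0 : 0 ≤ x) (hx1 : x ≤ 1) :
    (x / (1 + x)) * (Multiset.card A : ℝ) ≤
      ((A.filter (fun q => τ - Δ ≤ q ∧ q < τ - Δ + x * Δ)).card : ℝ) := by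

  have h := sw_shift Δ τ x hΔ hx0 A hloc
  have h2 := hopt (τ + x * Δ)
  rw [div_mul_eq_mul_div, div_le_iff₀ (by linarith)]
  refine le_of_mul_le_mul_left ?_ hΔ
  linarith
end
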